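/- arXiv:1611.00729 — 2 statements merged into one kernel-verified Lean document; each statement's English description precedes it below -/
import Mathlib

section
/- Let r_f ≥ 1, r_0 ≥ 1, set r := r_f/r_0, and let μ > 0, α > 0. For F ∈ ℝ^{3×3} and unit vectors ν, ν₀ ∈ ℝ³, the following are equivalent: (i) det F = 1 and W^e(F, ν, ν₀) + W^{ni}(F, ν, ν₀) = 0; (ii) det F = 1, FᵀF = ℓ_{ν₀} := r^{−1/3}(I₃ + (r−1) ν₀⊗ν₀), and ν = σ·Fν₀/|Fν₀| for some σ ∈ {−1, 1}. -/
open Matrix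

noncomputable section

/-- `v` is a unit vector in `ℝ³`. -/
def unit3 (v : Fin 3 → ℝ) : Prop := ∑ i, (v i) ^ 2 = 1

/-- Outer product `u ⊗ v` of vectors in `ℝ³`. -/
def outer3 (u v : Fin 3 → ℝ) : Matrix (Fin 3) (Fin 3) ℝ := Matrix.of fun i j => u i * v j

/-- Step-length tensor `ℓ_ν = r^{-1/3}(I₃ + (r-1) ν ⊗ ν)` with anisotropy parameter `r`. -/
def ell (r : ℝ) (v : Fin 3 → ℝ) : Matrix (Fin 3) (Fin 3) ℝ :=
  r ^ (-(1/3) : ℝ) • (1 + (r - 1) • outer3 v v)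

/-- Entropic energy density (finite branch). -/
def We (μ rf r0 : ℝ) (F : Matrix (Fin 3) (Fin 3) ℝ) (ν ν₀ : Fin 3 → ℝ) : ℝ :=
  μ / 2 * (Matrix.trace (Fᵀ * (ell rf ν)⁻¹ * F * ell r0 ν₀) - 3)

/-- Non-ideal energy density `W^{ni}(F,ν,ν₀) = (μα/2)|(I₃ - ν₀⊗ν₀)Fᵀν|²`. -/
def Wni (μ a : ℝ) (F : Matrix (Fin 3) (Fin 3) ℝ) (ν ν₀ : Fin 3 → ℝ) : ℝ :=
  μ * a / 2 * ∑ i, (((1 - outer3 ν₀ ν₀) * Fᵀ).mulVec ν i) ^ 2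

/-- Normalization `v / |v|` of a vector in `ℝ³`. -/
def nvec (v : Fin 3 → ℝ) : Fin 3 → ℝ := fun i => v i / Real.sqrt (∑ j, (v j) ^ 2)

theorem Matrix.PosDef.trace_sub_card_eq_sum_of_det_eq_one {n : Type*} [Fintype n] [DecidableEq n]
    {A : Matrix n n ℝ} (hA : A.PosDef) (hdet : A.det = 1) :
    A.trace - Fintype.card n =
      ∑ i, (hA.1.eigenvalues i - 1 - Real.log (hA.1.eigenvalues i)) := by
  have hlog : ∑ i, Real.log (hA.1.eigenvalues i) = 0 := by
    rw [← Real.log_prod fun i _ => (hA.eigenvalues_pos i).ne']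
    have := hA.1.det_eq_prod_eigenvalues
    simp only [RCLike.ofReal_real_eq_id, id_eq, hdet] at this
    rw [← this, Real.log_one]
  rw [Finset.sum_sub_distrib, hlog, hA.1.trace_eq_sum_eigenvalues]
  simp

theorem Matrix.PosDef.card_le_trace_of_det_eq_one {n : Type*} [Fintype n] [DecidableEq n]
    {A : Matrix n n ℝ} (hA : A.PosDef) (hdet : A.det = 1) : (Fintype.card n : ℝ) ≤ A.trace := by
  rw [← sub_nonneg, hA.trace_sub_card_eq_sum_of_det_eq_one hdet]
  exact Finset.sum_nonneg fun i _ =>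
    sub_nonneg.2 (Real.log_le_sub_one_of_pos (hA.eigenvalues_pos i))

theorem Matrix.PosDef.eq_one_of_det_eq_one_of_trace_eq_card {n : Type*} [Fintype n]
    [DecidableEq n] {A : Matrix n n ℝ} (hA : A.PosDef) (hdet : A.det = 1)
    (htr : A.trace = Fintype.card n) : A = 1 := by
  have hsum := hA.trace_sub_card_eq_sum_of_det_eq_one hdet
  rw [htr, sub_self, eq_comm, Finset.sum_eq_zero_iff_of_nonneg fun i _ =>
    sub_nonneg.2 (Real.log_le_sub_one_of_pos (hA.eigenvalues_pos i))] at hsum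
  have heig : ∀ i, hA.1.eigenvalues i = 1 := fun i => by
    by_contra hne
    have := Real.log_lt_sub_one_of_pos (hA.eigenvalues_pos i) hne
    linarith [hsum i (Finset.mem_univ i)]
  have hdiag : diagonal (RCLike.ofReal ∘ hA.1.eigenvalues) = (1 : Matrix n n ℝ) := by
    rw [← diagonal_one]
    congr 1
    ext i
    simp [heig]
  rw [hA.1.spectral_theorem, hdiag, map_one]

theorem outer3_eq_vecMulVec (u v : Fin 3 → ℝ) : outer3 u v = vecMulVec u v := rfl

theorem unit3.dotProduct_self {v : Fin 3 → ℝ} (hv : unit3 v) : v ⬝ᵥ v = 1 := by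
  simpa [unit3, dotProduct, pow_two] using hv

theorem ell_one (v : Fin 3 → ℝ) : ell 1 v = 1 := by simp [ell]

theorem transpose_ell (r : ℝ) (v : Fin 3 → ℝ) : (ell r v)ᵀ = ell r v := by
  simp [ell, outer3_eq_vecMulVec, transpose_vecMulVec]

theorem ell_mul_ell {r s : ℝ} (hr : 0 ≤ r) (hs : 0 ≤ s) {v : Fin 3 → ℝ} (hv : unit3 v) :
    ell r v * ell s v = ell (r * s) v := by
  have ho : outer3 v v * outer3 v v = outer3 v v := by
    rw [outer3_eq_vecMulVec, vecMulVec_mul_vecMulVec, hv.dotProduct_self, one_smul]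
  simp only [ell, Real.mul_rpow hr hs, smul_mul_smul_comm, add_mul, mul_add, one_mul, mul_one, ho]
  congr 1
  module

theorem ell_mul_ell_inv {r : ℝ} (hr : 0 < r) {v : Fin 3 → ℝ} (hv : unit3 v) :
    ell r v * ell r⁻¹ v = 1 := by
  rw [ell_mul_ell hr.le (inv_nonneg.2 hr.le) hv, mul_inv_cancel₀ hr.ne', ell_one]

theorem inv_ell {r : ℝ} (hr : 0 < r) {v : Fin 3 → ℝ} (hv : unit3 v) :
    (ell r v)⁻¹ = ell r⁻¹ v :=
  inv_eq_right_inv (ell_mul_ell_inv hr hv)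

theorem ell_sqrt_mul_ell_sqrt {r : ℝ} (hr : 0 ≤ r) {v : Fin 3 → ℝ} (hv : unit3 v) :
    ell √r v * ell √r v = ell r v := by
  rw [ell_mul_ell (Real.sqrt_nonneg r) (Real.sqrt_nonneg r) hv, Real.mul_self_sqrt hr]

theorem det_ell {r : ℝ} (hr : 0 < r) {v : Fin 3 → ℝ} (hv : unit3 v) : (ell r v).det = 1 := by
  have hpow : (r ^ (-(1/3) : ℝ)) ^ 3 = r⁻¹ := by
    rw [← Real.rpow_natCast, ← Real.rpow_mul hr.le, ← Real.rpow_neg_one]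
    norm_num
  have hdet : (1 + (r - 1) • outer3 v v).det = r := by
    have hv' := hv
    simp only [unit3, Fin.sum_univ_three] at hv'
    simp [det_fin_three, outer3]
    linear_combination (r - 1) * hv'
  rw [ell, det_smul, Fintype.card_fin, hpow, hdet, inv_mul_cancel₀ hr.ne']

theorem ell_mulVec_self (r : ℝ) {v : Fin 3 → ℝ} (hv : unit3 v) :
    ell r v *ᵥ v = (r ^ (-(1/3) : ℝ) * r) • v := by
  simp only [ell, outer3_eq_vecMulVec, smul_mulVec, add_mulVec, one_mulVec, vecMulVec_mulVec,
    hv.dotProduct_self, mul_smul]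
  simp only [MulOpposite.op_one, one_smul]
  congr 1
  module

/-- If `F` and its transpose map the lines of `ν₀` and `ν` onto each other with the same factor,
then `F` intertwines the step-length tensors along `ν₀` and `ν`. -/
theorem ell_mul_eq_mul_ell {F : Matrix (Fin 3) (Fin 3) ℝ} {ν ν₀ : Fin 3 → ℝ} {c : ℝ}
    (h : F *ᵥ ν₀ = c • ν) (hT : Fᵀ *ᵥ ν = c • ν₀) (s : ℝ) :
    ell s ν * F = F * ell s ν₀ := by
  have ho : outer3 ν ν * F = F * outer3 ν₀ ν₀ := by
    rw [outer3_eq_vecMulVec, outer3_eq_vecMulVec, vecMulVec_mul, mul_vecMulVec, h,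
      ← mulVec_transpose, hT, vecMulVec_smul, smul_vecMulVec]
  simp only [ell, smul_mul, Matrix.mul_smul, add_mul, mul_add, one_mul, mul_one, ho]

theorem sum_sq_eq_zero_iff {v : Fin 3 → ℝ} : ∑ i, (v i) ^ 2 = 0 ↔ v = 0 := by
  rw [Finset.sum_eq_zero_iff_of_nonneg fun i _ => sq_nonneg _]
  simp [funext_iff]

theorem Wni_nonneg {μ a : ℝ} (hμ : 0 < μ) (ha : 0 < a) (F : Matrix (Fin 3) (Fin 3) ℝ)
    (ν ν₀ : Fin 3 → ℝ) : 0 ≤ Wni μ a F ν ν₀ := by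
  unfold Wni
  positivity

theorem projection_mulVec (F : Matrix (Fin 3) (Fin 3) ℝ) (ν ν₀ : Fin 3 → ℝ) :
    ((1 - outer3 ν₀ ν₀) * Fᵀ) *ᵥ ν = Fᵀ *ᵥ ν - (ν₀ ⬝ᵥ Fᵀ *ᵥ ν) • ν₀ := by
  rw [← mulVec_mulVec, sub_mulVec, one_mulVec, outer3_eq_vecMulVec, vecMulVec_mulVec,
    op_smul_eq_smul]

theorem Wni_eq_zero_iff {μ a : ℝ} (hμ : 0 < μ) (ha : 0 < a) {F : Matrix (Fin 3) (Fin 3) ℝ}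
    {ν ν₀ : Fin 3 → ℝ} (hν₀ : unit3 ν₀) :
    Wni μ a F ν ν₀ = 0 ↔ ∃ c : ℝ, Fᵀ *ᵥ ν = c • ν₀ := by
  have hpos : μ * a / 2 ≠ 0 := by positivity
  rw [Wni, mul_eq_zero, or_iff_right hpos, sum_sq_eq_zero_iff, projection_mulVec, sub_eq_zero]
  refine ⟨fun h => ⟨_, h⟩, fun ⟨c, hc⟩ => ?_⟩
  rw [hc, dotProduct_smul, hν₀.dotProduct_self, smul_eq_mul, mul_one]

/-- The matrix `(ℓ^f)^{-1/2} F (ℓ⁰)^{1/2}`. -/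
def relDeformation (rf r0 : ℝ) (F : Matrix (Fin 3) (Fin 3) ℝ) (ν ν₀ : Fin 3 → ℝ) :
    Matrix (Fin 3) (Fin 3) ℝ :=
  ell √rf⁻¹ ν * F * ell √r0 ν₀

section

variable {rf r0 : ℝ} {F : Matrix (Fin 3) (Fin 3) ℝ} {ν ν₀ : Fin 3 → ℝ}

theorem relDeformation_gram (hrf : 0 < rf) (hν : unit3 ν) :
    (relDeformation rf r0 F ν ν₀)ᵀ * relDeformation rf r0 F ν ν₀ =
      ell √r0 ν₀ * (Fᵀ * ell rf⁻¹ ν * F) * ell √r0 ν₀ := by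
  rw [← ell_sqrt_mul_ell_sqrt (inv_nonneg.2 hrf.le) hν]
  simp only [relDeformation, transpose_mul, transpose_ell, Matrix.mul_assoc]

theorem det_relDeformation (hrf : 0 < rf) (hr0 : 0 < r0) (hν : unit3 ν) (hν₀ : unit3 ν₀)
    (hF : F.det = 1) : (relDeformation rf r0 F ν ν₀).det = 1 := by
  rw [relDeformation, det_mul, det_mul, det_ell (by positivity) hν, det_ell (by positivity) hν₀, hF]
  norm_num

theorem We_eq_trace_gram (μ : ℝ) (hrf : 0 < rf) (hr0 : 0 < r0) (hν : unit3 ν)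
    (hν₀ : unit3 ν₀) :
    We μ rf r0 F ν ν₀ =
      μ / 2 * (((relDeformation rf r0 F ν ν₀)ᵀ * relDeformation rf r0 F ν ν₀).trace - 3) := by
  rw [We, inv_ell hrf hν, relDeformation_gram hrf hν, trace_mul_comm (ell _ _ * _),
    ← Matrix.mul_assoc, ell_sqrt_mul_ell_sqrt hr0.le hν₀, trace_mul_comm]

theorem posDef_relDeformation_gram (hrf : 0 < rf) (hr0 : 0 < r0) (hν : unit3 ν)
    (hν₀ : unit3 ν₀) (hF : F.det = 1) :
    ((relDeformation rf r0 F ν ν₀)ᵀ * relDeformation rf r0 F ν ν₀).PosDef := by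
  rw [← conjTranspose_eq_transpose_of_trivial]
  refine PosDef.conjTranspose_mul_self _ (mulVec_injective_of_isUnit ?_)
  rw [isUnit_iff_isUnit_det, det_relDeformation hrf hr0 hν hν₀ hF]
  exact isUnit_one

theorem We_nonneg {μ : ℝ} (hμ : 0 < μ) (hrf : 0 < rf) (hr0 : 0 < r0) (hν : unit3 ν)
    (hν₀ : unit3 ν₀) (hF : F.det = 1) : 0 ≤ We μ rf r0 F ν ν₀ := by
  have h := (posDef_relDeformation_gram hrf hr0 hν hν₀ hF).card_le_trace_of_det_eq_one
    (by rw [det_mul, det_transpose, det_relDeformation hrf hr0 hν hν₀ hF, one_mul])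
  rw [Fintype.card_fin, Nat.cast_ofNat] at h
  rw [We_eq_trace_gram μ hrf hr0 hν hν₀]
  exact mul_nonneg (by positivity) (sub_nonneg.2 h)

theorem We_eq_zero_iff {μ : ℝ} (hμ : 0 < μ) (hrf : 0 < rf) (hr0 : 0 < r0) (hν : unit3 ν)
    (hν₀ : unit3 ν₀) (hF : F.det = 1) :
    We μ rf r0 F ν ν₀ = 0 ↔ Fᵀ * ell rf⁻¹ ν * F = ell r0⁻¹ ν₀ := by
  constructor
  · intro h
    rw [We_eq_trace_gram μ hrf hr0 hν hν₀, mul_eq_zero, or_iff_right (by positivity),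
      sub_eq_zero] at h
    have h1 := (posDef_relDeformation_gram hrf hr0 hν hν₀ hF).eq_one_of_det_eq_one_of_trace_eq_card
      (by rw [det_mul, det_transpose, det_relDeformation hrf hr0 hν hν₀ hF, one_mul])
      (by rw [h, Fintype.card_fin, Nat.cast_ofNat])
    rw [relDeformation_gram hrf hν] at h1
    have hl := ell_mul_ell_inv (Real.sqrt_pos.2 hr0) hν₀
    have hl' := mul_eq_one_comm.1 hl
    calc Fᵀ * ell rf⁻¹ ν * F
        = ell (√r0)⁻¹ ν₀ * ell √r0 ν₀ * (Fᵀ * ell rf⁻¹ ν * F) *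
            (ell √r0 ν₀ * ell (√r0)⁻¹ ν₀) := by rw [hl, hl', one_mul, mul_one]
      _ = ell (√r0)⁻¹ ν₀ * (ell √r0 ν₀ * (Fᵀ * ell rf⁻¹ ν * F) * ell √r0 ν₀) *
            ell (√r0)⁻¹ ν₀ := by simp only [Matrix.mul_assoc]
      _ = ell r0⁻¹ ν₀ := by
        rw [h1, mul_one, ← Real.sqrt_inv, ell_sqrt_mul_ell_sqrt (inv_nonneg.2 hr0.le) hν₀]
  · intro h
    rw [We, inv_ell hrf hν, h, mul_eq_one_comm.1 (ell_mul_ell_inv hr0 hν₀)]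
    simp

theorem mulVec_eq_smul_of_gram_eq {s t c : ℝ} (hs : 0 < s) (hν : unit3 ν)
    (hν₀ : unit3 ν₀) (hF : F.det = 1) (hT : Fᵀ *ᵥ ν = c • ν₀)
    (h : Fᵀ * ell s ν * F = ell t ν₀) : c ≠ 0 ∧ F *ᵥ ν₀ = c • ν := by
  have hinj : Function.Injective Fᵀ.mulVec := mulVec_injective_of_isUnit
    ((isUnit_iff_isUnit_det _).2 (by rw [det_transpose, hF]; exact isUnit_one))
  have hc : c ≠ 0 := by
    rintro rfl
    have h0 : ν = 0 := hinj (by rw [hT, zero_smul, mulVec_zero])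
    simpa [h0] using hν.dotProduct_self
  have hdot : ν ⬝ᵥ F *ᵥ ν₀ = c := by
    rw [dotProduct_mulVec, ← mulVec_transpose, hT, smul_dotProduct, hν₀.dotProduct_self,
      smul_eq_mul, mul_one]
  obtain ⟨k, hk⟩ : ∃ k : ℝ, F *ᵥ ν₀ = k • ν := by
    have h1 : Fᵀ *ᵥ (ell s ν *ᵥ (F *ᵥ ν₀)) = Fᵀ *ᵥ ((t ^ (-(1/3) : ℝ) * t * c⁻¹) • ν) := by
      rw [mulVec_mulVec, mulVec_mulVec, h, ell_mulVec_self t hν₀, mulVec_smul, hT, smul_smul,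
        inv_mul_cancel_right₀ hc]
    have h2 := congrArg (ell s⁻¹ ν *ᵥ ·) (hinj h1)
    simp only [mulVec_smul, ell_mulVec_self _ hν, smul_smul] at h2
    rw [mulVec_mulVec, mul_eq_one_comm.1 (ell_mul_ell_inv hs hν), one_mulVec] at h2
    exact ⟨_, h2⟩
  rw [hk, dotProduct_smul, hν.dotProduct_self, smul_eq_mul, mul_one] at hdot
  exact ⟨hc, hdot ▸ hk⟩

end

theorem nvec_smul_of_unit3 {v : Fin 3 → ℝ} (hv : unit3 v) (c : ℝ) :
    nvec (c • v) = (c / |c|) • v := by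
  have hs : ∑ j, ((c • v) j) ^ 2 = c ^ 2 := by
    have hv' : ∑ i, (v i) ^ 2 = 1 := hv
    simp only [Pi.smul_apply, smul_eq_mul, mul_pow, ← Finset.mul_sum, hv', mul_one]
  ext i
  rw [nvec, hs, Real.sqrt_sq_eq_abs]
  simp only [Pi.smul_apply, smul_eq_mul]
  ring

theorem exists_eq_sign_smul_nvec {v : Fin 3 → ℝ} (hv : unit3 v) {c : ℝ} (hc : c ≠ 0) :
    ∃ σ : ℝ, (σ = -1 ∨ σ = 1) ∧ v = σ • nvec (c • v) := by
  rw [nvec_smul_of_unit3 hv]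
  rcases hc.lt_or_gt with h | h
  · exact ⟨-1, Or.inl rfl, by rw [abs_of_neg h, div_neg, div_self hc]; simp⟩
  · exact ⟨1, Or.inr rfl, by rw [abs_of_pos h, div_self hc]; simp⟩

theorem nvec_eq_smul (v : Fin 3 → ℝ) : nvec v = (√(∑ j, (v j) ^ 2))⁻¹ • v := by
  ext i
  simp [nvec, div_eq_inv_mul]

theorem mulVec_eq_smul_of_eq_smul_nvec {r σ : ℝ} {F : Matrix (Fin 3) (Fin 3) ℝ}
    {ν ν₀ : Fin 3 → ℝ} (hν : unit3 ν) (hν₀ : unit3 ν₀) (h : Fᵀ * F = ell r ν₀)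
    (hσ : ν = σ • nvec (F *ᵥ ν₀)) : ∃ c : ℝ, F *ᵥ ν₀ = c • ν ∧ Fᵀ *ᵥ ν = c • ν₀ := by
  rw [nvec_eq_smul, smul_smul] at hσ
  set k := σ * (√(∑ j, ((F *ᵥ ν₀) j) ^ 2))⁻¹
  have hk : k ≠ 0 := by
    intro hk
    rw [hk, zero_smul] at hσ
    simpa [hσ] using hν.dotProduct_self
  have hF : F *ᵥ ν₀ = k⁻¹ • ν := by rw [hσ, inv_smul_smul₀ hk]
  have hT : Fᵀ *ᵥ ν = (k * (r ^ (-(1/3) : ℝ) * r)) • ν₀ := by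
    rw [hσ, mulVec_smul, mulVec_mulVec, h, ell_mulVec_self r hν₀, smul_smul]
  have hdot : ν ⬝ᵥ F *ᵥ ν₀ = Fᵀ *ᵥ ν ⬝ᵥ ν₀ := by rw [dotProduct_mulVec, mulVec_transpose]
  rw [hT, hF, dotProduct_smul, smul_dotProduct, hν.dotProduct_self, hν₀.dotProduct_self,
    smul_eq_mul, smul_eq_mul, mul_one, mul_one] at hdot
  exact ⟨k⁻¹, hF, hdot ▸ hT⟩

/-- with `r = r_f/r_0`, `det F = 1 ∧ W^e + W^{ni} = 0` iff
`det F = 1`, `FᵀF = ℓ_{ν₀}` and `ν = σ Fν₀/|Fν₀|` for some `σ ∈ {-1,1}`. -/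
theorem statement4 (rf r0 μ a : ℝ) (hrf : 1 ≤ rf) (hr0 : 1 ≤ r0) (hμ : 0 < μ) (ha : 0 < a)
    (F : Matrix (Fin 3) (Fin 3) ℝ) (ν ν₀ : Fin 3 → ℝ) (hν : unit3 ν) (hν₀ : unit3 ν₀) :
    (F.det = 1 ∧ We μ rf r0 F ν ν₀ + Wni μ a F ν ν₀ = 0) ↔
    (F.det = 1 ∧ Fᵀ * F = ell (rf / r0) ν₀ ∧
      ∃ σ : ℝ, (σ = -1 ∨ σ = 1) ∧ ν = σ • nvec (F.mulVec ν₀)) := by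
  have hrf' : 0 < rf := by linarith
  have hr0' : 0 < r0 := by linarith
  refine and_congr_right fun hF => ?_
  rw [add_eq_zero_iff_of_nonneg (We_nonneg hμ hrf' hr0' hν hν₀ hF) (Wni_nonneg hμ ha F ν ν₀),
    We_eq_zero_iff hμ hrf' hr0' hν hν₀ hF, Wni_eq_zero_iff hμ ha hν₀]
  constructor
  · rintro ⟨h, c, hT⟩
    obtain ⟨hc, hFν₀⟩ :=
      mulVec_eq_smul_of_gram_eq (inv_pos.2 hrf') hν hν₀ hF hT h
    refine ⟨?_, hFν₀ ▸ exists_eq_sign_smul_nvec hν hc⟩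
    rw [Matrix.mul_assoc, ell_mul_eq_mul_ell hFν₀ hT, ← Matrix.mul_assoc] at h
    calc Fᵀ * F = Fᵀ * F * (ell rf⁻¹ ν₀ * ell rf ν₀) := by
          rw [mul_eq_one_comm.1 (ell_mul_ell_inv hrf' hν₀), mul_one]
      _ = ell (rf / r0) ν₀ := by
          rw [← Matrix.mul_assoc, h, ell_mul_ell (inv_nonneg.2 hr0'.le) hrf'.le hν₀,
            div_eq_inv_mul]
  · rintro ⟨h, σ, -, hσ⟩
    obtain ⟨c, hFν₀, hT⟩ := mulVec_eq_smul_of_eq_smul_nvec hν hν₀ h hσ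
    refine ⟨?_, c, hT⟩
    rw [Matrix.mul_assoc, ell_mul_eq_mul_ell hFν₀ hT, ← Matrix.mul_assoc, h,
      ell_mul_ell (by positivity) (by positivity) hν₀]
    congr 1
    field_simp
end
end

section
/- Let 0 < r < 1, let F̃ ∈ ℝ^{3×2}, and let ν₀ ∈ ℝ³ be a unit vector. Then F̃ᵀF̃ = ℓ̃_{ν₀} if and only if F̃ ∈ D_r and ν₀ ∈ N^r_{F̃}, where for r < 1 the inequalities in the definition of D_r are reversed and the sign condition in N^r_{F̃} is reversed. -/
open Matrix

noncomputable section

/-- Squared Frobenius norm of a matrix. -/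
def frob2 {m n : Type*} [Fintype m] [Fintype n] (A : Matrix m n ℝ) : ℝ :=
  ∑ i, ∑ j, (A i j) ^ 2

/-- Two-dimensional tensor `ℓ̃_ν = r^{-1/3}(I₂ + (r-1) ν̃ ⊗ ν̃)`, where `ν̃` is the
planar projection of `ν`. -/
def ellT (r : ℝ) (v : Fin 3 → ℝ) : Matrix (Fin 2) (Fin 2) ℝ :=
  r ^ (-(1/3) : ℝ) • (1 + (r - 1) • Matrix.of (fun i j : Fin 2 => v i.castSucc * v j.castSucc))

/-- Squared length of the `j`-th column `F ẽ_j` of `F ∈ ℝ^{3×2}`. -/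
def colsq (F : Matrix (Fin 3) (Fin 2) ℝ) (j : Fin 2) : ℝ := ∑ i, (F i j) ^ 2

/-- Dot product `F ẽ₁ · F ẽ₂` of the columns of `F ∈ ℝ^{3×2}`. -/
def coldot (F : Matrix (Fin 3) (Fin 2) ℝ) : ℝ := ∑ i, F i 0 * F i 1

/-- If `q = ± c * p` with `c < 0`, and `p`, `q` have opposite signs, then `q = c * p`. -/
theorem eq_mul_of_sq_eq_of_sign_eq_neg {c p q : ℝ} (hc : c < 0) (hsq : q ^ 2 = (c * p) ^ 2)
    (hsign : Real.sign p = -Real.sign q) : q = c * p := by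
  rcases sq_eq_sq_iff_eq_or_eq_neg.mp hsq with h | h
  · exact h
  · rcases lt_trichotomy p 0 with hp | hp | hp
    · have hq : q < 0 := by nlinarith
      rw [Real.sign_of_neg hp, Real.sign_of_neg hq] at hsign
      norm_num at hsign
    · simp [h, hp]
    · have hq : 0 < q := by nlinarith
      rw [Real.sign_of_pos hp, Real.sign_of_pos hq] at hsign
      norm_num at hsign

theorem sign_eq_neg_sign_mul_of_neg {c : ℝ} (hc : c < 0) (p : ℝ) :
    Real.sign p = -Real.sign (c * p) := by
  rcases lt_trichotomy p 0 with hp | hp | hp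
  · rw [Real.sign_of_neg hp, Real.sign_of_pos (mul_pos_of_neg_of_neg hc hp)]
  · simp [hp]
  · rw [Real.sign_of_pos hp, Real.sign_of_neg (mul_neg_of_neg_of_pos hc hp), neg_neg]

theorem frob2_eq_colsq_add_colsq (F : Matrix (Fin 3) (Fin 2) ℝ) :
    frob2 F = colsq F 0 + colsq F 1 := by
  simp [frob2, colsq, Fin.sum_univ_succ]
  ring

theorem transpose_mul_self_eq_ellT_iff {r : ℝ} (hr0 : 0 < r) (F : Matrix (Fin 3) (Fin 2) ℝ)
    (v : Fin 3 → ℝ) :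
    Fᵀ * F = ellT r v ↔
      (∀ j : Fin 2, colsq F j = r ^ (-(1/3) : ℝ) +
        (r ^ ((2/3) : ℝ) - r ^ (-(1/3) : ℝ)) * (v j.castSucc) ^ 2) ∧
      coldot F = (r ^ ((2/3) : ℝ) - r ^ (-(1/3) : ℝ)) * (v 0 * v 1) := by
  have hb : r ^ ((2/3) : ℝ) = r ^ (-(1/3) : ℝ) * r := by
    rw [← Real.rpow_add_one hr0.ne']
    norm_num
  rw [hb]
  generalize ha : r ^ (-(1/3) : ℝ) = a
  simp only [← Matrix.ext_iff, ellT, ha, Fin.forall_fin_two, Matrix.mul_apply,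
    Matrix.transpose_apply, Matrix.smul_apply, Matrix.add_apply, Matrix.one_apply, Matrix.of_apply,
    smul_eq_mul, colsq, coldot, Fin.sum_univ_three, Fin.castSucc_zero, Fin.castSucc_one]
  norm_num
  constructor
  · rintro ⟨⟨h₁, h₂⟩, -, h₃⟩
    exact ⟨⟨by linarith, by linarith⟩, by linarith⟩
  · rintro ⟨⟨h₁, h₃⟩, h₂⟩
    exact ⟨⟨by linarith, by linarith⟩, by linarith, by linarith⟩

/-- `0 < r < 1`: `F̃ᵀF̃ = ℓ̃_{ν₀}` iff `F̃ ∈ D_r` and `ν₀ ∈ N^r_{F̃}`,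
with the inequalities in `D_r` and the sign condition in `N^r_{F̃}` reversed. -/
theorem statement7 (r : ℝ) (hr0 : 0 < r) (hr1 : r < 1)
    (F : Matrix (Fin 3) (Fin 2) ℝ) (ν₀ : Fin 3 → ℝ) (hν₀ : unit3 ν₀) :
    Fᵀ * F = ellT r ν₀ ↔
      ((r ^ (-(1/3) : ℝ) + r ^ ((2/3) : ℝ) ≤ frob2 F ∧
        (∀ j : Fin 2, r ^ ((2/3) : ℝ) ≤ colsq F j ∧ colsq F j ≤ r ^ (-(1/3) : ℝ)) ∧
        (coldot F) ^ 2 = (colsq F 0 - r ^ (-(1/3) : ℝ)) * (colsq F 1 - r ^ (-(1/3) : ℝ))) ∧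
       ((∀ j : Fin 2, (ν₀ j.castSucc) ^ 2 =
          (colsq F j - r ^ (-(1/3) : ℝ)) / (r ^ ((2/3) : ℝ) - r ^ (-(1/3) : ℝ))) ∧
        Real.sign (ν₀ 0 * ν₀ 1) = -Real.sign (coldot F))) := by
  have hab : r ^ ((2/3) : ℝ) < r ^ (-(1/3) : ℝ) :=
    Real.rpow_lt_rpow_of_exponent_gt hr0 hr1 (by norm_num)
  rw [transpose_mul_self_eq_ellT_iff hr0, frob2_eq_colsq_add_colsq]
  generalize r ^ ((2/3) : ℝ) = b at *
  generalize r ^ (-(1/3) : ℝ) = a at *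
  have hc : b - a < 0 := sub_neg.mpr hab
  simp only [unit3, Fin.sum_univ_three] at hν₀
  simp only [Fin.forall_fin_two, Fin.castSucc_zero, Fin.castSucc_one, eq_div_iff hc.ne]
  constructor
  · rintro ⟨⟨h₀, h₁⟩, hd⟩
    rw [h₀, h₁, hd]
    have hx := sq_nonneg (ν₀ 0)
    have hy := sq_nonneg (ν₀ 1)
    have hz := sq_nonneg (ν₀ 2)
    exact ⟨⟨by nlinarith, ⟨⟨by nlinarith, by nlinarith⟩, by nlinarith, by nlinarith⟩, by ring⟩,
      ⟨by ring, by ring⟩, sign_eq_neg_sign_mul_of_neg hc _⟩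
  · rintro ⟨⟨-, -, hd⟩, ⟨h₀, h₁⟩, hs⟩
    refine ⟨⟨by linarith, by linarith⟩, eq_mul_of_sq_eq_of_sign_eq_neg hc ?_ hs⟩
    rw [hd, ← h₀, ← h₁]
    ring
end
end
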